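/- arXiv:2304.04810 — 5 statements merged into one kernel-verified Lean document; each statement's English description precedes it below -/
import Mathlib

section
/- Let P be a finite poset with |P| ≥ 2 and L = J(P). For each maximal chain C of L let v_C ∈ ℚ^{L∖{∅,P}} be the 0/1 indicator vector of the set C ∖ {∅, P}. Then the ℚ-vector subspace of ℚ^{L∖{∅,P}} spanned by the vectors v_C, as C ranges over all maximal chains of L, has dimension |L| − |P|. -/
variable (P : Type*) [PartialOrder P] [Fintype P]

/-- A maximal chain of the lattice `L = J(P)` of order ideals of `P`, encoded (as in the
paper) as the sequence `∅ = c_0 ⊂ c_1 ⊂ ⋯ ⊂ c_{|P|} = P` of its elements, where `|c_k| = k`. -/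
def IsMaxChainSeq (f : Fin (Fintype.card P + 1) → Finset P) : Prop :=
  (∀ k, IsLowerSet (f k : Set P)) ∧
    (∀ k : Fin (Fintype.card P), f k.castSucc ⊆ f k.succ) ∧
    (∀ k, (f k).card = (k : ℕ))

/-- The maximal chains of `L = J(P)`. -/
def MaxChain : Type _ := {f : Fin (Fintype.card P + 1) → Finset P // IsMaxChainSeq P f}

/-- The elements of `L = J(P)` other than `∅` and `P`. -/
def ProperIdeal : Type _ :=
  {I : Finset P // IsLowerSet (I : Set P) ∧ I ≠ ∅ ∧ I ≠ Finset.univ}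

-- The indicator vector `v_C ∈ ℚ^{L∖{∅,P}}` of the set `C ∖ {∅, P}` for a maximal
-- chain `C` of `L`.
open Classical in
noncomputable def chainVector (c : MaxChain P) : ProperIdeal P → ℚ := fun x =>
  if ∃ k, c.1 k = x.1 then 1 else 0

section Helpers

theorem up_chain {Q : Type*} [PartialOrder Q] [Fintype Q] (m : ℕ) :
    ∀ A : Finset Q, IsLowerSet (A : Set Q) → Fintype.card Q - A.card = m →
    ∃ g : ℕ → Finset Q, g A.card = A ∧
      (∀ k, A.card ≤ k → k ≤ Fintype.card Q → IsLowerSet (g k : Set Q) ∧ (g k).card = k) ∧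
      (∀ k, A.card ≤ k → k < Fintype.card Q → g k ⊆ g (k+1)) := by
  classical
  induction m with
  | zero =>
    intro A hA hm
    have := A.card_le_univ
    refine ⟨fun _ => A, rfl, ?_, ?_⟩
    · intro k h1 h2
      exact ⟨hA, by show A.card = k; omega⟩
    · intro k h1 h2
      omega
  | succ m ih =>
    intro A hA hm
    have hne : (Finset.univ \ A).Nonempty := by
      rw [← Finset.card_pos, Finset.card_univ_sdiff]
      omega
    obtain ⟨b, hb⟩ := (Finset.univ \ A).exists_minimal hne
    have hbA : b ∉ A := by
      have := hb.1
      simpa using this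
    have hl : IsLowerSet ((insert b A : Finset Q) : Set Q) := by
      intro x y hyx hx
      simp only [Finset.coe_insert, Set.mem_insert_iff, Finset.mem_coe] at hx ⊢
      rcases hx with rfl | hx
      · by_cases hy : y ∈ A
        · exact Or.inr hy
        · left
          exact le_antisymm hyx (hb.2 (by simpa using hy) hyx)
      · exact Or.inr (hA hyx hx)
    have hc : (insert b A).card = A.card + 1 := Finset.card_insert_of_notMem hbA
    obtain ⟨g, g1, g2, g3⟩ := ih (insert b A) hl (by omega)
    rw [hc] at g1 g2 g3
    refine ⟨fun k => if k = A.card then A else g k, by simp, ?_, ?_⟩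
    · intro k h1 h2
      by_cases h : k = A.card
      · simp only [h, if_true]
        exact ⟨hA, trivial⟩
      · simp only [h, if_false]
        exact g2 k (by omega) h2
    · intro k h1 h2
      by_cases h : k = A.card
      · subst h
        simp [g1]
      · have h' : k + 1 ≠ A.card := by omega
        simp only [h, h', if_false]
        exact g3 k (by omega) h2

theorem down_chain {Q : Type*} [PartialOrder Q] [Fintype Q] (m : ℕ) :
    ∀ A : Finset Q, IsLowerSet (A : Set Q) → A.card = m →
    ∃ g : ℕ → Finset Q, g m = A ∧
      (∀ k, k ≤ m → IsLowerSet (g k : Set Q) ∧ (g k).card = k) ∧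
      (∀ k, k < m → g k ⊆ g (k+1)) := by
  classical
  induction m with
  | zero =>
    intro A hA hm
    refine ⟨fun _ => A, rfl, ?_, ?_⟩
    · intro k h1
      exact ⟨hA, by show A.card = k; omega⟩
    · intro k h1
      omega
  | succ m ih =>
    intro A hA hm
    have hne : A.Nonempty := by
      rw [← Finset.card_pos]
      omega
    obtain ⟨b, hb⟩ := A.exists_maximal hne
    have hl : IsLowerSet ((A.erase b : Finset Q) : Set Q) := by
      intro x y hyx hx
      simp only [Finset.mem_coe, Finset.mem_erase] at hx ⊢
      refine ⟨?_, hA hyx hx.2⟩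
      rintro rfl
      exact hx.1 (le_antisymm (hb.2 hx.2 hyx) hyx)
    have hc : (A.erase b).card = m := by
      rw [Finset.card_erase_of_mem hb.1]
      omega
    obtain ⟨g, g1, g2, g3⟩ := ih (A.erase b) hl hc
    refine ⟨fun k => if k = m + 1 then A else g k, by simp, ?_, ?_⟩
    · intro k h1
      by_cases h : k = m + 1
      · simp only [h, if_true]
        exact ⟨hA, hm⟩
      · simp only [h, if_false]
        exact g2 k (by omega)
    · intro k h1
      have h : k ≠ m + 1 := by omega
      by_cases h' : k + 1 = m + 1
      · obtain rfl : k = m := by omega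
        simp [g1, Finset.erase_subset]
      · simp only [h, h', if_false]
        exact g3 k (by omega)

open Classical in
noncomputable def eVec (Q : Type*) [PartialOrder Q] [Fintype Q] (A : Finset Q) :
    ProperIdeal Q → ℚ := fun x => if x.1 = A then 1 else 0

theorem card_lt_succ' {Q : Type*} [Fintype Q] (A : Finset Q) :
    A.card < Fintype.card Q + 1 := Nat.lt_succ_of_le A.card_le_univ

open Classical in
theorem chainVector_apply' {Q : Type*} [PartialOrder Q] [Fintype Q] (c : MaxChain Q)
    (x : ProperIdeal Q) :
    chainVector Q c x = if c.1 ⟨x.1.card, card_lt_succ' x.1⟩ = x.1 then 1 else 0 := by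
  unfold chainVector
  congr 1
  apply propext
  constructor
  · rintro ⟨k, hk⟩
    have h := c.2.2.2 k
    rw [hk] at h
    have : (⟨x.1.card, card_lt_succ' x.1⟩ : Fin (Fintype.card Q + 1)) = k := Fin.ext h
    rw [this, hk]
  · intro h
    exact ⟨_, h⟩

theorem chain_diff {Q : Type*} [PartialOrder Q] [Fintype Q] (K I J M : Finset Q)
    (hK : IsLowerSet (K : Set Q)) (hI : IsLowerSet (I : Set Q)) (hJ : IsLowerSet (J : Set Q))
    (hM : IsLowerSet (M : Set Q)) (h1 : K ⊆ I) (h2 : K ⊆ J) (h3 : I ⊆ M) (h4 : J ⊆ M)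
    (cI : I.card = K.card + 1) (cJ : J.card = K.card + 1) (cM : M.card = K.card + 2) :
    eVec Q I - eVec Q J ∈ Submodule.span ℚ (Set.range (chainVector Q)) := by
  classical
  obtain ⟨d, d1, d2, d3⟩ := down_chain K.card K hK rfl
  obtain ⟨u, u1, u2, u3⟩ := up_chain _ M hM rfl
  have hMc := M.card_le_univ
  have key : ∀ X : Finset Q, IsLowerSet (X : Set Q) → K ⊆ X → X ⊆ M → X.card = K.card + 1 →
      IsMaxChainSeq Q (fun k => if (k : ℕ) ≤ K.card then d k else
        if (k : ℕ) = K.card + 1 then X else u k) := by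
    intro X hX hKX hXM cX
    refine ⟨?_, ?_, ?_⟩
    · intro k
      have := k.2
      dsimp only
      split_ifs with a b
      · exact (d2 _ a).1
      · exact hX
      · exact (u2 _ (by omega) (by omega)).1
    · intro k
      have := k.2
      simp only [Fin.val_castSucc, Fin.val_succ]
      rcases lt_trichotomy (k : ℕ) K.card with h | h | h
      · rw [if_pos h.le, if_pos (by omega)]
        exact d3 _ h
      · rw [if_pos h.le, if_neg (by omega), if_pos (by omega), h, d1]
        exact hKX
      · rw [if_neg (by omega : ¬ (k : ℕ) ≤ K.card), if_neg (by omega : ¬ (k : ℕ) + 1 ≤ K.card),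
          if_neg (by omega : ¬ (k : ℕ) + 1 = K.card + 1)]
        split_ifs with hh
        · have : (k : ℕ) + 1 = M.card := by omega
          rw [this, u1]
          exact hXM
        · exact u3 _ (by omega) (by omega)
    · intro k
      have := k.2
      dsimp only
      split_ifs with a b
      · exact (d2 _ a).2
      · omega
      · exact (u2 _ (by omega) (by omega)).2
  have key2 : ∀ X : Finset Q, IsLowerSet (X : Set Q) → K ⊆ X → X ⊆ M → X.card = K.card + 1 →
      ∃ c : MaxChain Q, ∀ x : ProperIdeal Q, chainVector Q c x =
        if (if x.1.card ≤ K.card then d x.1.card else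
        if x.1.card = K.card + 1 then X else u x.1.card) = x.1 then 1 else 0 := by
    intro X hX hKX hXM cX
    refine ⟨⟨_, key X hX hKX hXM cX⟩, fun x => ?_⟩
    refine (chainVector_apply' _ x).trans ?_
    rfl
  obtain ⟨c, hc⟩ := key2 I hI h1 h3 cI
  obtain ⟨c', hc'⟩ := key2 J hJ h2 h4 cJ
  have e : eVec Q I - eVec Q J = chainVector Q c - chainVector Q c' := by
    funext x
    rw [Pi.sub_apply, Pi.sub_apply, hc, hc']
    unfold eVec
    obtain ⟨x, hx0⟩ := x
    dsimp only
    by_cases hx : x.card = K.card + 1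
    · have hx' : ¬ x.card ≤ K.card := by omega
      rw [if_neg hx', if_neg hx', if_pos hx, if_pos hx]
      simp only [eq_comm]
    · have n1 : x ≠ I := fun h => hx (by rw [h, cI])
      have n2 : x ≠ J := fun h => hx (by rw [h, cJ])
      rw [if_neg n1, if_neg n2, if_neg hx, if_neg hx, sub_self, sub_self]
  rw [e]
  exact Submodule.sub_mem _ (Submodule.subset_span ⟨_, rfl⟩) (Submodule.subset_span ⟨_, rfl⟩)

theorem same_rank {Q : Type*} [PartialOrder Q] [Fintype Q] (J : Finset Q)
    (hJ : IsLowerSet (J : Set Q)) (m : ℕ) : ∀ I : Finset Q, IsLowerSet (I : Set Q) →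
    I.card = J.card → (∃ D : Finset Q, (∀ x, x ∈ D ↔ x ∈ I ∧ x ∉ J) ∧ D.card = m) →
    eVec Q I - eVec Q J ∈ Submodule.span ℚ (Set.range (chainVector Q)) := by
  classical
  induction m with
  | zero =>
    rintro I hI hc ⟨D, hD, hD0⟩
    rw [Finset.card_eq_zero] at hD0
    subst hD0
    have : I = J := by
      apply Finset.eq_of_subset_of_card_le _ hc.ge
      intro x hx
      by_contra h
      exact absurd ((hD x).2 ⟨hx, h⟩) (Finset.notMem_empty x)
    rw [this, sub_self]
    exact Submodule.zero_mem _
  | succ m ih =>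
    rintro I hI hc ⟨D, hD, hDc⟩
    have hDne : D.Nonempty := by
      rw [← Finset.card_pos]; omega
    have hne2 : (J \ I).Nonempty := by
      rw [← Finset.card_pos, ← Finset.card_sdiff_comm hc]
      have : I \ J = D := by ext x; simp [hD]
      rw [this]; omega
    obtain ⟨a, ha⟩ := D.exists_maximal hDne
    obtain ⟨b, hb⟩ := (J \ I).exists_minimal hne2
    obtain ⟨haI, haJ⟩ := (hD a).1 ha.1
    obtain ⟨hbJ, hbI⟩ := Finset.mem_sdiff.1 hb.1
    have hab : a ≠ b := by rintro rfl; exact hbI haI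
    have hbelow : ∀ y, y ≤ b → y = b ∨ (y ∈ I ∧ y ≠ a) := by
      intro y hy
      have hyJ : y ∈ J := hJ hy hbJ
      by_cases hyI : y ∈ I
      · right
        refine ⟨hyI, ?_⟩
        rintro rfl
        exact haJ hyJ
      · left
        exact le_antisymm hy (hb.2 (Finset.mem_sdiff.2 ⟨hyJ, hyI⟩) hy)
    have hK : IsLowerSet ((I.erase a : Finset Q) : Set Q) := by
      intro x y hyx hx
      simp only [Finset.mem_coe, Finset.mem_erase] at hx ⊢
      refine ⟨?_, hI hyx hx.2⟩
      rintro rfl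
      by_cases hxJ : x ∈ J
      · exact haJ (hJ hyx hxJ)
      · exact hx.1 (le_antisymm (ha.2 ((hD x).2 ⟨hx.2, hxJ⟩) hyx) hyx)
    have hK' : IsLowerSet ((insert b (I.erase a) : Finset Q) : Set Q) := by
      intro x y hyx hx
      simp only [Finset.mem_coe, Finset.mem_insert] at hx ⊢
      rcases hx with rfl | hx
      · rcases hbelow y hyx with h | h
        · exact Or.inl h
        · exact Or.inr (Finset.mem_erase.2 ⟨h.2, h.1⟩)
      · exact Or.inr (hK hyx hx)
    have hM : IsLowerSet ((insert b I : Finset Q) : Set Q) := by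
      intro x y hyx hx
      simp only [Finset.mem_coe, Finset.mem_insert] at hx ⊢
      rcases hx with rfl | hx
      · rcases hbelow y hyx with h | h
        · exact Or.inl h
        · exact Or.inr h.1
      · exact Or.inr (hI hyx hx)
    have c1 : (I.erase a).card + 1 = I.card := Finset.card_erase_add_one haI
    have c2 : (insert b (I.erase a)).card = (I.erase a).card + 1 :=
      Finset.card_insert_of_notMem (fun h => hbI (Finset.mem_of_mem_erase h))
    have c3 : (insert b I).card = I.card + 1 := Finset.card_insert_of_notMem hbI
    have s1 := chain_diff (I.erase a) I (insert b (I.erase a)) (insert b I) hK hI hK' hM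
      (Finset.erase_subset _ _) (Finset.subset_insert _ _) (Finset.subset_insert _ _)
      (Finset.insert_subset_insert _ (Finset.erase_subset _ _)) c1.symm c2 (by omega)
    have s2 := ih (insert b (I.erase a)) hK' (by omega) ⟨D.erase a, by
      intro x
      simp only [Finset.mem_erase, Finset.mem_insert, hD]
      constructor
      · rintro ⟨h1, h2, h3⟩
        exact ⟨Or.inr ⟨h1, h2⟩, h3⟩
      · rintro ⟨rfl | h, h3⟩
        · exact absurd hbJ h3
        · exact ⟨h.1, h.2, h3⟩, by
      have := Finset.card_erase_add_one ha.1
      omega⟩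
    have := Submodule.add_mem _ s1 s2
    rwa [sub_add_sub_cancel] at this

instance finProper (Q : Type*) [PartialOrder Q] [Fintype Q] : Finite (ProperIdeal Q) :=
  inferInstanceAs (Finite {I : Finset Q // IsLowerSet (I : Set Q) ∧ I ≠ ∅ ∧ I ≠ Finset.univ})

noncomputable instance fintypeProper (Q : Type*) [PartialOrder Q] [Fintype Q] :
    Fintype (ProperIdeal Q) := Fintype.ofFinite _

theorem card_ideals (Q : Type*) [PartialOrder Q] [Fintype Q] (h : 2 ≤ Fintype.card Q) :
    Nat.card {I : Finset Q // IsLowerSet (I : Set Q)} = Fintype.card (ProperIdeal Q) + 2 := by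
  classical
  have h1 : Fintype.card (ProperIdeal Q) = Nat.card
      {I : Finset Q // IsLowerSet (I : Set Q) ∧ I ≠ ∅ ∧ I ≠ Finset.univ} := by
    rw [← Nat.card_eq_fintype_card]; rfl
  rw [h1, Nat.card_eq_fintype_card, Nat.card_eq_fintype_card, Fintype.card_subtype,
    Fintype.card_subtype]
  have hne : (∅ : Finset Q) ≠ Finset.univ := by
    intro hh
    have := congrArg Finset.card hh
    rw [Finset.card_empty, Finset.card_univ] at this
    omega
  have : (Finset.univ.filter fun I : Finset Q => IsLowerSet (I : Set Q)) =
      insert ∅ (insert Finset.univ (Finset.univ.filter fun I : Finset Q =>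
        IsLowerSet (I : Set Q) ∧ I ≠ ∅ ∧ I ≠ Finset.univ)) := by
    ext I
    simp only [Finset.mem_filter, Finset.mem_univ, true_and, Finset.mem_insert]
    constructor
    · intro h
      by_cases a : I = ∅
      · exact Or.inl a
      · by_cases b : I = Finset.univ
        · exact Or.inr (Or.inl b)
        · exact Or.inr (Or.inr ⟨h, a, b⟩)
    · rintro (rfl | rfl | h)
      · simpa using isLowerSet_empty
      · simpa using isLowerSet_univ
      · exact h.1
  rw [this, Finset.card_insert_of_notMem, Finset.card_insert_of_notMem]
  · simp
  · simp [hne]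

/-- rank sums -/
noncomputable def rankSum (Q : Type*) [PartialOrder Q] [Fintype Q] :
    (ProperIdeal Q → ℚ) →ₗ[ℚ] (Fin (Fintype.card Q - 1) → ℚ) where
  toFun v j := ∑ x : ProperIdeal Q, if x.1.card = (j : ℕ) + 1 then v x else 0
  map_add' v w := by
    funext j
    simp only [Pi.add_apply, ← Finset.sum_add_distrib]
    exact Finset.sum_congr rfl fun x _ => by split_ifs <;> simp
  map_smul' r v := by
    funext j
    simp only [Pi.smul_apply, smul_eq_mul, RingHom.id_apply, Finset.mul_sum]
    exact Finset.sum_congr rfl fun x _ => by split_ifs <;> simp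

theorem rankSum_apply' {Q : Type*} [PartialOrder Q] [Fintype Q] (v : ProperIdeal Q → ℚ)
    (j : Fin (Fintype.card Q - 1)) :
    rankSum Q v j = ∑ x : ProperIdeal Q, if x.1.card = (j : ℕ) + 1 then v x else 0 := rfl

theorem proper_card {Q : Type*} [PartialOrder Q] [Fintype Q] (x : ProperIdeal Q) :
    1 ≤ x.1.card ∧ x.1.card < Fintype.card Q := by
  constructor
  · exact Finset.card_pos.2 (Finset.nonempty_iff_ne_empty.2 x.2.2.1)
  · exact Finset.card_lt_univ_of_notMem (x := (by
      have := x.2.2.2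
      rw [Ne, Finset.eq_univ_iff_forall, not_forall] at this
      exact this.choose)) (by
      have := x.2.2.2
      rw [Ne, Finset.eq_univ_iff_forall, not_forall] at this
      exact this.choose_spec)

theorem exists_chain (Q : Type*) [PartialOrder Q] [Fintype Q] : Nonempty (MaxChain Q) := by
  obtain ⟨u, u1, u2, u3⟩ := up_chain (Q := Q) _ ∅ (by simpa using isLowerSet_empty) rfl
  refine ⟨⟨fun k => u k, ?_, ?_, ?_⟩⟩
  · intro k
    exact (u2 k (by simp) (by omega)).1
  · intro k
    exact u3 k (by simp) (by omega)
  · intro k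
    exact (u2 k (by simp) (by omega)).2

/-- member of a chain as a proper ideal -/
def chainElt {Q : Type*} [PartialOrder Q] [Fintype Q] (c : MaxChain Q)
    (j : Fin (Fintype.card Q - 1)) : ProperIdeal Q :=
  ⟨c.1 ⟨j + 1, by omega⟩, c.2.1 _, by
    intro h
    have := c.2.2.2 ⟨j + 1, by omega⟩
    rw [h] at this
    simp at this, by
    intro h
    have := c.2.2.2 ⟨j + 1, by omega⟩
    rw [h, Finset.card_univ] at this
    simp at this
    omega⟩

theorem chainElt_card {Q : Type*} [PartialOrder Q] [Fintype Q] (c : MaxChain Q)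
    (j : Fin (Fintype.card Q - 1)) : (chainElt c j).1.card = (j : ℕ) + 1 := c.2.2.2 _

theorem rankSum_chain {Q : Type*} [PartialOrder Q] [Fintype Q] (c : MaxChain Q) :
    rankSum Q (chainVector Q c) = 1 := by
  classical
  funext j
  rw [rankSum_apply', Finset.sum_eq_single (chainElt c j)]
  · rw [if_pos (chainElt_card c j)]
    unfold chainVector
    rw [if_pos ⟨_, rfl⟩]
    rfl
  · intro x _ hx
    split_ifs with h
    · rw [chainVector_apply', if_neg]
      intro h'
      apply hx
      apply Subtype.ext
      rw [← h']
      simp only [h]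
      rfl
    · rfl
  · simp

theorem rankSum_eVec {Q : Type*} [PartialOrder Q] [Fintype Q] (x : ProperIdeal Q)
    (j : Fin (Fintype.card Q - 1)) :
    rankSum Q (eVec Q x.1) j = if x.1.card = (j : ℕ) + 1 then 1 else 0 := by
  classical
  rw [rankSum_apply', Finset.sum_eq_single x]
  · simp [eVec]
  · intro y _ hy
    have : y.1 ≠ x.1 := fun h => hy (Subtype.ext h)
    simp [eVec, this]
  · simp

theorem rankSum_surj (Q : Type*) [PartialOrder Q] [Fintype Q] :
    Function.Surjective (rankSum Q) := by
  classical
  obtain ⟨c⟩ := exists_chain Q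
  intro w
  refine ⟨∑ j, w j • eVec Q (chainElt c j).1, ?_⟩
  funext i
  rw [map_sum, Finset.sum_apply, Finset.sum_eq_single i]
  · simp [rankSum_eVec, chainElt_card]
  · intro j _ hj
    have : (j : ℕ) ≠ i := fun h => hj (Fin.ext h)
    simp [rankSum_eVec, chainElt_card, this]
  · simp

theorem ker_le (Q : Type*) [PartialOrder Q] [Fintype Q] :
    LinearMap.ker (rankSum Q) ≤ Submodule.span ℚ (Set.range (chainVector Q)) := by
  classical
  obtain ⟨c⟩ := exists_chain Q
  intro v hv
  rw [LinearMap.mem_ker] at hv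
  have e : v = ∑ x : ProperIdeal Q,
      v x • (eVec Q x.1 - eVec Q (c.1 ⟨x.1.card, card_lt_succ' x.1⟩)) := by
    simp only [smul_sub, Finset.sum_sub_distrib]
    have a1 : ∑ x : ProperIdeal Q, v x • eVec Q x.1 = v := by
      funext y
      rw [Finset.sum_apply, Finset.sum_eq_single y]
      · simp [eVec]
      · intro x _ hx
        have : y.1 ≠ x.1 := fun h => hx (Subtype.ext h.symm)
        simp [eVec, this]
      · simp
    have a2 : ∑ x : ProperIdeal Q, v x • eVec Q (c.1 ⟨x.1.card, card_lt_succ' x.1⟩) = 0 := by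
      funext y
      rw [Finset.sum_apply]
      by_cases hy : c.1 ⟨y.1.card, card_lt_succ' y.1⟩ = y.1
      · obtain ⟨p1, p2⟩ := proper_card y
        have := congrFun hv ⟨y.1.card - 1, by omega⟩
        rw [rankSum_apply'] at this
        refine Eq.trans ?_ this
        apply Finset.sum_congr rfl
        intro x _
        simp only [Pi.smul_apply, eVec, smul_eq_mul, mul_ite, mul_one, mul_zero]
        congr 1
        apply propext
        constructor
        · intro h
          rw [h, c.2.2.2]
          simp only
          have := congrArg Finset.card h
          rw [c.2.2.2] at this
          simp only at this
          omega
        · intro h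
          have : x.1.card = y.1.card := by omega
          simp only [this, hy]
      · apply Finset.sum_eq_zero
        intro x _
        have : y.1 ≠ c.1 ⟨x.1.card, card_lt_succ' x.1⟩ := by
          intro h
          have h2 := congrArg Finset.card h
          rw [c.2.2.2] at h2
          simp only at h2
          apply hy
          simp only [h2]
          exact h.symm
        simp [eVec, this]
    rw [a1, a2, sub_zero]
  rw [e]
  refine Submodule.sum_mem _ fun x _ => Submodule.smul_mem _ _ ?_
  exact same_rank _ (c.2.1 _) _ x.1 x.2.1 (c.2.2.2 ⟨x.1.card, card_lt_succ' x.1⟩).symm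
    ⟨x.1 \ c.1 ⟨x.1.card, card_lt_succ' x.1⟩, fun y => Finset.mem_sdiff, rfl⟩

theorem main_aux (Q : Type*) [PartialOrder Q] [Fintype Q] (hQ : 2 ≤ Fintype.card Q) :
    Module.finrank ℚ ↥(Submodule.span ℚ (Set.range (chainVector Q))) =
      Nat.card {I : Finset Q // IsLowerSet (I : Set Q)} - Fintype.card Q := by
  set W := Submodule.span ℚ (Set.range (chainVector Q)) with hW
  have r1 := (rankSum Q).finrank_range_add_finrank_ker
  rw [LinearMap.range_eq_top.2 (rankSum_surj Q), finrank_top, Module.finrank_fin_fun,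
    Module.finrank_fintype_fun_eq_card] at r1
  have r2 := ((rankSum Q).domRestrict W).finrank_range_add_finrank_ker
  have hr : LinearMap.range ((rankSum Q).domRestrict W) = Submodule.span ℚ {1} := by
    rw [LinearMap.range_domRestrict, hW, Submodule.map_span]
    congr 1
    obtain ⟨c⟩ := exists_chain Q
    ext w
    simp only [Set.mem_image, Set.mem_range, Set.mem_singleton_iff]
    constructor
    · rintro ⟨_, ⟨c, rfl⟩, rfl⟩
      exact rankSum_chain c
    · rintro rfl
      exact ⟨_, ⟨c, rfl⟩, rankSum_chain c⟩
  have h1 : (1 : Fin (Fintype.card Q - 1) → ℚ) ≠ 0 := by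
    intro h
    have := congrFun h ⟨0, by omega⟩
    simp at this
  have hk : Module.finrank ℚ (LinearMap.ker ((rankSum Q).domRestrict W)) =
      Module.finrank ℚ (LinearMap.ker (rankSum Q)) := by
    rw [LinearMap.ker_domRestrict]
    exact (Submodule.comapSubtypeEquivOfLe (ker_le Q)).finrank_eq
  rw [hr, finrank_span_singleton h1, hk] at r2
  rw [card_ideals Q hQ]
  omega

end Helpers

/-- If `|P| ≥ 2`, the `ℚ`-vector subspace of `ℚ^{L∖{∅,P}}` spanned by the
indicator vectors `v_C` of the maximal chains `C` of `L = J(P)` has dimension `|L| − |P|`. -/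
theorem finrank_span_chainVectors (hP : 2 ≤ Fintype.card P) :
    Module.finrank ℚ ↥(Submodule.span ℚ (Set.range (chainVector P))) =
      Nat.card {I : Finset P // IsLowerSet (I : Set P)} - Fintype.card P := by
  exact main_aux P hP
end

section
/- Let P be a finite poset, L = J(P) its lattice of order ideals, and let I ≠ J be order ideals of P. Then there exist maximal chains A and B of L with A ∖ B = {I} and B ∖ A = {J} (set-theoretic differences of the underlying sets of the chains) if and only if |I| = |J| and |I ∪ J| = |I| + 1. -/
variable (P : Type*) [PartialOrder P] [Fintype P] [DecidableEq P]

/-- The order ideals of `P`, i.e. the elements of the lattice `L = J(P)`,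
ordered by inclusion. -/
def OrderIdeal : Type _ := {I : Finset P // IsLowerSet (I : Set P)}

instance : PartialOrder (OrderIdeal P) := Subtype.partialOrder _

theorem mem_of_maxChain_aux {α : Type*} [PartialOrder α] {A : Set α}
    (hA : IsMaxChain (· ≤ ·) A) {M : α} (h : ∀ K ∈ A, M ≤ K ∨ K ≤ M) : M ∈ A := by
  have hc : IsChain (· ≤ ·) (insert M A) := hA.1.insert (fun b hb _ => h b hb)
  have := hA.2 hc (Set.subset_insert _ _)
  rw [this]
  exact Set.mem_insert _ _

theorem squeeze_aux {α : Type*} [DecidableEq α] {I J K : Finset α}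
    (h1 : I.card = J.card) (h2 : (I ∪ J).card = I.card + 1) (hK : K ≠ I)
    (a : K ⊆ I ∩ J ∨ I ∩ J ⊆ K) (b : K ⊆ I ∨ I ⊆ K) (c : K ⊆ I ∪ J ∨ I ∪ J ⊆ K) :
    K ⊆ I ∩ J ∨ I ∪ J ⊆ K := by
  have h3 := Finset.card_union_add_card_inter I J
  rcases a with a | a
  · exact Or.inl a
  rcases c with c | c
  swap
  · exact Or.inr c
  rcases b with b | b
  · left
    have : K.card < I.card := Finset.card_lt_card (b.ssubset_of_ne hK)
    exact (Finset.eq_of_subset_of_card_le a (by omega)).ge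
  · right
    have : I.card < K.card := Finset.card_lt_card (b.ssubset_of_ne hK.symm)
    exact (Finset.eq_of_subset_of_card_le c (by omega)).ge

theorem forward_aux {P : Type*} [PartialOrder P] [Fintype P] [DecidableEq P]
    (I J : OrderIdeal P) (hIJ : I ≠ J) (A B : Set (OrderIdeal P))
    (hA : IsMaxChain (· ≤ ·) A) (hB : IsMaxChain (· ≤ ·) B)
    (hAB : A \ B = {I}) (hBA : B \ A = {J}) : (I.1 ∪ J.1).card = I.1.card + 1 := by
  have hI : I ∈ A ∧ I ∉ B := by
    have : I ∈ A \ B := by rw [hAB]; rfl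
    exact this
  have hJ : J ∈ B ∧ J ∉ A := by
    have : J ∈ B \ A := by rw [hBA]; rfl
    exact this
  have hAm : ∀ K ∈ A, K ≠ I → K ∈ B := by
    intro K hK hne
    by_contra hn
    have : K ∈ A \ B := ⟨hK, hn⟩
    rw [hAB] at this
    exact hne this
  have hinc : ¬ (J ≤ I ∨ I ≤ J) := by
    intro h
    apply hJ.2
    apply mem_of_maxChain_aux hA
    intro K hK
    by_cases e : K = I
    · rw [e]; exact h
    · exact hB.1.total hJ.1 (hAm K hK e)
  push Not at hinc
  have key : ∀ K ∈ A, K ≠ I → (K ≤ I ∧ K ≤ J) ∨ (I ≤ K ∧ J ≤ K) := by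
    intro K hK hne
    have t1 := hA.1.total hK hI.1
    have t2 := hB.1.total (hAm K hK hne) hJ.1
    rcases t1 with t1 | t1 <;> rcases t2 with t2 | t2
    · exact Or.inl ⟨t1, t2⟩
    · exact absurd (t2.trans t1) hinc.1
    · exact absurd (t1.trans t2) hinc.2
    · exact Or.inr ⟨t1, t2⟩
  have hne : (J.1 \ I.1).Nonempty := by
    rw [Finset.sdiff_nonempty]
    exact hinc.1
  obtain ⟨x, hx⟩ := (J.1 \ I.1).exists_minimal hne
  have hxm := Finset.mem_sdiff.1 hx.1
  have hlow : IsLowerSet ((insert x I.1 : Finset P) : Set P) := by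
    intro a b hba ha
    simp only [Finset.coe_insert, Set.mem_insert_iff, Finset.mem_coe] at ha ⊢
    rcases ha with rfl | ha
    · by_cases hb : b ∈ I.1
      · exact Or.inr hb
      · left
        have hbJ : b ∈ J.1 := J.2 hba hxm.1
        exact le_antisymm hba (hx.2 (Finset.mem_sdiff.2 ⟨hbJ, hb⟩) hba)
    · exact Or.inr (I.2 hba ha)
  let M : OrderIdeal P := ⟨insert x I.1, hlow⟩
  have hIM : I ≤ M := Finset.subset_insert x I.1
  have hMI : M ≠ I := by
    intro h
    apply hxm.2
    rw [← h]
    exact Finset.mem_insert_self _ _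
  have hMA : M ∈ A := by
    apply mem_of_maxChain_aux hA
    intro K hK
    by_cases e : K = I
    · rw [e]; exact Or.inr hIM
    · rcases key K hK e with k | k
      · exact Or.inr (k.1.trans hIM)
      · left
        exact Finset.insert_subset (k.2 hxm.1) k.1
  have hJM : J ≤ M := by
    rcases key M hMA hMI with k | k
    · exact absurd (le_antisymm k.1 hIM) hMI
    · exact k.2
  have e : I.1 ∪ J.1 = insert x I.1 := by
    apply Finset.Subset.antisymm
    · exact Finset.union_subset hIM hJM
    · exact Finset.insert_subset (Finset.mem_union_right _ hxm.1) Finset.subset_union_left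
  rw [e, Finset.card_insert_of_notMem hxm.2]

/-- For distinct order ideals `I ≠ J` of `P`, there exist maximal chains
`A` and `B` of `L = J(P)` with `A ∖ B = {I}` and `B ∖ A = {J}` iff `|I| = |J|` and
`|I ∪ J| = |I| + 1`. -/
theorem exists_maxChains_diff_singletons_iff (I J : OrderIdeal P) (hIJ : I ≠ J) :
    (∃ A B : Set (OrderIdeal P), IsMaxChain (· ≤ ·) A ∧ IsMaxChain (· ≤ ·) B ∧
        A \ B = {I} ∧ B \ A = {J}) ↔
      I.1.card = J.1.card ∧ (I.1 ∪ J.1).card = I.1.card + 1 := by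
  constructor
  · rintro ⟨A, B, hA, hB, hAB, hBA⟩
    have h1 := forward_aux I J hIJ A B hA hB hAB hBA
    have h2 := forward_aux J I hIJ.symm B A hB hA hBA hAB
    rw [Finset.union_comm] at h2
    exact ⟨by omega, h1⟩
  · rintro ⟨h1, h2⟩
    have h2' : (J.1 ∪ I.1).card = J.1.card + 1 := by rw [Finset.union_comm]; omega
    let U : OrderIdeal P := ⟨I.1 ∪ J.1, by rw [Finset.coe_union]; exact I.2.union J.2⟩
    let D : OrderIdeal P := ⟨I.1 ∩ J.1, by rw [Finset.coe_inter]; exact I.2.inter J.2⟩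
    have hDI : D ≤ I := Finset.inter_subset_left
    have hDJ : D ≤ J := Finset.inter_subset_right
    have hIU : I ≤ U := Finset.subset_union_left
    have hJU : J ≤ U := Finset.subset_union_right
    have hij : ¬ I ≤ J := fun h => hIJ (Subtype.ext (Finset.eq_of_subset_of_card_le h h1.ge))
    have hji : ¬ J ≤ I := fun h => hIJ (Subtype.ext (Finset.eq_of_subset_of_card_le h h1.le)).symm
    have sq1 : ∀ K : OrderIdeal P, K ≠ I → (K ≤ D ∨ D ≤ K) → (K ≤ I ∨ I ≤ K) →
        (K ≤ U ∨ U ≤ K) → K ≤ D ∨ U ≤ K := fun K hK a b c =>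
      squeeze_aux h1 h2 (fun e => hK (Subtype.ext e)) a b c
    have sq2 : ∀ K : OrderIdeal P, K ≠ J → (K ≤ D ∨ D ≤ K) → (K ≤ J ∨ J ≤ K) →
        (K ≤ U ∨ U ≤ K) → K ≤ D ∨ U ≤ K := by
      intro K hK a b c
      have := squeeze_aux (K := K.1) h1.symm h2' (fun e => hK (Subtype.ext e))
        (by rw [Finset.inter_comm]; exact a) b (by rw [Finset.union_comm]; exact c)
      rw [Finset.inter_comm, Finset.union_comm] at this
      exact this
    have hch : IsChain (· ≤ ·) ({D, I, U} : Set (OrderIdeal P)) := by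
      refine (IsChain.pair hIU).insert ?_
      rintro b (rfl | rfl) _
      · exact Or.inl hDI
      · exact Or.inl (hDI.trans hIU)
    obtain ⟨A, hA, hsub⟩ := hch.exists_maxChain
    have hDA : D ∈ A := hsub (by simp)
    have hIA : I ∈ A := hsub (by simp)
    have hUA : U ∈ A := hsub (by simp)
    have key : ∀ K ∈ A, K ≠ I → K ≤ D ∨ U ≤ K := fun K hK hne =>
      sq1 K hne (hA.1.total hK hDA) (hA.1.total hK hIA) (hA.1.total hK hUA)
    have hJA : J ∉ A := fun h => (hA.1.total hIA h).elim hij hji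
    have hDnI : D ≠ I := fun e => hij (e ▸ hDJ)
    have hUnI : U ≠ I := fun e => hji (e ▸ hJU)
    have hBc : IsChain (· ≤ ·) (insert J (A \ {I})) := by
      refine hA.1.diff.insert ?_
      intro K hK _
      rcases key K hK.1 hK.2 with k | k
      · exact Or.inr (k.trans hDJ)
      · exact Or.inl (hJU.trans k)
    refine ⟨A, insert J (A \ {I}), hA, ⟨hBc, ?_⟩, ?_, ?_⟩
    · intro t ht hs
      refine Set.Subset.antisymm hs ?_
      intro M hM
      by_cases hMJ : M = J
      · exact Or.inl hMJ
      have hJt : J ∈ t := hs (Or.inl rfl)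
      have hDt : D ∈ t := hs (Or.inr ⟨hDA, hDnI⟩)
      have hUt : U ∈ t := hs (Or.inr ⟨hUA, hUnI⟩)
      have k := sq2 M hMJ (ht.total hM hDt) (ht.total hM hJt) (ht.total hM hUt)
      refine Or.inr ⟨mem_of_maxChain_aux hA ?_, ?_⟩
      · intro K hK
        by_cases e : K = I
        · rw [e]
          exact k.imp (fun h => h.trans hDI) (fun h => hIU.trans h)
        · exact ht.total hM (hs (Or.inr ⟨hK, e⟩))
      · rintro rfl
        exact (ht.total hM hJt).elim hij hji
    · ext K
      constructor
      · rintro ⟨a, b⟩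
        by_contra hn
        exact b (Or.inr ⟨a, hn⟩)
      · rintro rfl
        exact ⟨hIA, fun h => h.elim hIJ (fun h => h.2 rfl)⟩
    · ext K
      constructor
      · rintro ⟨a | a, b⟩
        · exact a
        · exact absurd a.1 b
      · rintro rfl
        exact ⟨Or.inl rfl, hJA⟩
end

section
/- Let P be a finite poset of width at most 2 and L = J(P). Then: (i) for any two maximal chains C and D of L, the families C ∧ D and C ∨ D are again maximal chains of L; (ii) the relation ≼_ch is a partial order on the set of maximal chains of L; and (iii) the set of maximal chains of L, ordered by ≼_ch, is a distributive lattice in which the meet of C and D is C ∧ D and the join is C ∨ D. -/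
variable (P : Type*) [PartialOrder P] [Fintype P] [DecidableEq P]

/-- The meet `C ∧ D` of two maximal chains (as families):
`(C ∧ D)_k = c_k` if `|c_k ∩ A| ≤ |d_k ∩ A|`, and `(C ∧ D)_k = d_k` otherwise. -/
def meetFun (A : Finset P) (f g : Fin (Fintype.card P + 1) → Finset P) :
    Fin (Fintype.card P + 1) → Finset P := fun k =>
  if (f k ∩ A).card ≤ (g k ∩ A).card then f k else g k

/-- The join `C ∨ D` of two maximal chains (as families):
`(C ∨ D)_k = d_k` if `|c_k ∩ A| ≤ |d_k ∩ A|`, and `(C ∨ D)_k = c_k` otherwise. -/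
def joinFun (A : Finset P) (f g : Fin (Fintype.card P + 1) → Finset P) :
    Fin (Fintype.card P + 1) → Finset P := fun k =>
  if (f k ∩ A).card ≤ (g k ∩ A).card then g k else f k

/-- The relation `C ≼_ch D` on maximal chains: `|c_k ∩ A| ≤ |d_k ∩ A|` for all `k`. -/
def chLE (A : Finset P) (C D : MaxChain P) : Prop :=
  ∀ k, (C.1 k ∩ A).card ≤ (D.1 k ∩ A).card

theorem aux_sub {A I J : Finset P} (hA : IsChain (· ≤ ·) (A : Set P))
    (hI : IsLowerSet (I : Set P)) (hJ : IsLowerSet (J : Set P))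
    (h : (I ∩ A).card ≤ (J ∩ A).card) : I ∩ A ⊆ J ∩ A := by
  by_contra hn
  obtain ⟨x, hx, hxJ⟩ := Finset.not_subset.1 hn
  have hx' := Finset.mem_inter.1 hx
  have hxJ' : x ∉ J := fun h' => hxJ (Finset.mem_inter.2 ⟨h', hx'.2⟩)
  have hs : J ∩ A ⊆ I ∩ A := by
    intro y hy
    have hy' := Finset.mem_inter.1 hy
    refine Finset.mem_inter.2 ⟨?_, hy'.2⟩
    rcases hA.total (Finset.mem_coe.2 hx'.2) (Finset.mem_coe.2 hy'.2) with hxy | hxy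
    · exact absurd (Finset.mem_coe.1 (hJ hxy (Finset.mem_coe.2 hy'.1))) hxJ'
    · exact Finset.mem_coe.1 (hI hxy (Finset.mem_coe.2 hx'.1))
  have := Finset.eq_of_subset_of_card_le hs h
  exact hxJ (this ▸ hx)

theorem aux_card {A B : Finset P} (hAB : Disjoint A B) (hU : A ∪ B = Finset.univ)
    (I : Finset P) : (I ∩ A).card + (I ∩ B).card = I.card := by
  rw [← Finset.card_union_of_disjoint, ← Finset.inter_union_distrib_left, hU, Finset.inter_univ]
  exact hAB.mono Finset.inter_subset_right Finset.inter_subset_right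

theorem aux_le {A B I J : Finset P} (hA : IsChain (· ≤ ·) (A : Set P))
    (hB : IsChain (· ≤ ·) (B : Set P)) (hU : A ∪ B = Finset.univ)
    (hI : IsLowerSet (I : Set P)) (hJ : IsLowerSet (J : Set P))
    (h : (I ∩ A).card ≤ (J ∩ A).card) (h' : (I ∩ B).card ≤ (J ∩ B).card) : I ⊆ J := by
  have h1 := aux_sub P hA hI hJ h
  have h2 := aux_sub P hB hI hJ h'
  have := Finset.union_subset_union h1 h2
  rwa [← Finset.inter_union_distrib_left, ← Finset.inter_union_distrib_left, hU,
    Finset.inter_univ, Finset.inter_univ] at this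

theorem aux_closed {A B : Finset P} (hA : IsChain (· ≤ ·) (A : Set P))
    (hB : IsChain (· ≤ ·) (B : Set P)) (hAB : Disjoint A B) (hU : A ∪ B = Finset.univ)
    (C D : MaxChain P) :
    IsMaxChainSeq P (meetFun P A C.1 D.1) ∧ IsMaxChainSeq P (joinFun P A C.1 D.1) := by
  obtain ⟨f, hf1, hf2, hf3⟩ := C
  obtain ⟨g, hg1, hg2, hg3⟩ := D
  have key : ∀ k : Fin (Fintype.card P),
      meetFun P A f g k.castSucc ⊆ meetFun P A f g k.succ ∧
      joinFun P A f g k.castSucc ⊆ joinFun P A f g k.succ := by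
    intro k
    have a1 := Finset.card_le_card (Finset.inter_subset_inter_right (u := A) (hf2 k))
    have a2 := Finset.card_le_card (Finset.inter_subset_inter_right (u := A) (hg2 k))
    have b1 := Finset.card_le_card (Finset.inter_subset_inter_right (u := B) (hf2 k))
    have b2 := Finset.card_le_card (Finset.inter_subset_inter_right (u := B) (hg2 k))
    have c1 := aux_card P hAB hU (f k.castSucc)
    have c2 := aux_card P hAB hU (f k.succ)
    have c3 := aux_card P hAB hU (g k.castSucc)
    have c4 := aux_card P hAB hU (g k.succ)
    rw [hf3] at c1 c2
    rw [hg3] at c3 c4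
    simp only [Fin.val_castSucc, Fin.val_succ] at c1 c2 c3 c4
    unfold meetFun joinFun
    split_ifs <;> constructor <;>
      first
      | exact hf2 k
      | exact hg2 k
      | (apply aux_le P hA hB hU <;> first | apply hf1 | apply hg1 | omega)
  refine ⟨⟨?_, fun k => (key k).1, ?_⟩, ⟨?_, fun k => (key k).2, ?_⟩⟩ <;> intro k <;>
    simp only [meetFun, joinFun] <;> split_ifs <;>
    first | apply hf1 | apply hg1 | apply hf3 | apply hg3

theorem aux_antisymm {A B : Finset P} (hA : IsChain (· ≤ ·) (A : Set P))
    (hB : IsChain (· ≤ ·) (B : Set P)) (hAB : Disjoint A B) (hU : A ∪ B = Finset.univ)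
    (C D : MaxChain P) (h : chLE P A C D) (h' : chLE P A D C) : C = D := by
  apply Subtype.ext
  funext k
  have c1 := aux_card P hAB hU (C.1 k)
  have c2 := aux_card P hAB hU (D.1 k)
  rw [C.2.2.2] at c1
  rw [D.2.2.2] at c2
  have h1 := h k
  have h2 := h' k
  exact Finset.Subset.antisymm
    (aux_le P hA hB hU (C.2.1 k) (D.2.1 k) h1 (by omega))
    (aux_le P hA hB hU (D.2.1 k) (C.2.1 k) h2 (by omega))

theorem card_meet (A : Finset P) (f g : Fin (Fintype.card P + 1) → Finset P) (k) :
    (meetFun P A f g k ∩ A).card = min (f k ∩ A).card (g k ∩ A).card := by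
  unfold meetFun; split_ifs <;> omega

theorem card_join (A : Finset P) (f g : Fin (Fintype.card P + 1) → Finset P) (k) :
    (joinFun P A f g k ∩ A).card = max (f k ∩ A).card (g k ∩ A).card := by
  unfold joinFun; split_ifs <;> omega

/-- Let `P` have width at most 2, partitioned into two disjoint chains `A`
and `B`. Then (i) the meet and join of two maximal chains of `L = J(P)` are again maximal
chains; (ii) `≼_ch` is a partial order on the maximal chains; (iii) the maximal chains form
a distributive lattice under `≼_ch`, with the given meet and join. -/
theorem maxChains_distribLattice (A B : Finset P)
    (hwidth : ∀ S : Finset P, IsAntichain (· ≤ ·) (S : Set P) → S.card ≤ 2)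
    (hA : IsChain (· ≤ ·) (A : Set P)) (hB : IsChain (· ≤ ·) (B : Set P))
    (hAB : Disjoint A B) (hUnion : A ∪ B = Finset.univ) :
    (∀ C D : MaxChain P,
      IsMaxChainSeq P (meetFun P A C.1 D.1) ∧ IsMaxChainSeq P (joinFun P A C.1 D.1)) ∧
    IsPartialOrder (MaxChain P) (chLE P A) ∧
    ∃ s : DistribLattice (MaxChain P),
      (∀ C D : MaxChain P, (letI := s; C ≤ D) ↔ chLE P A C D) ∧
      (∀ C D : MaxChain P, letI := s; (C ⊓ D).1 = meetFun P A C.1 D.1) ∧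
      (∀ C D : MaxChain P, letI := s; (C ⊔ D).1 = joinFun P A C.1 D.1) := by
  have hc := aux_closed P hA hB hAB hUnion
  have ha := aux_antisymm P hA hB hAB hUnion
  have hr : ∀ C, chLE P A C C := fun C k => le_rfl
  have ht : ∀ C D E, chLE P A C D → chLE P A D E → chLE P A C E :=
    fun C D E h h' k => (h k).trans (h' k)
  refine ⟨hc, { refl := hr, trans := ht, antisymm := ha }, ?_⟩
  refine ⟨{ le := chLE P A
            le_refl := hr
            le_trans := ht
            le_antisymm := ha
            inf := fun C D => ⟨meetFun P A C.1 D.1, (hc C D).1⟩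
            sup := fun C D => ⟨joinFun P A C.1 D.1, (hc C D).2⟩
            le_sup_left := ?_
            le_sup_right := ?_
            sup_le := ?_
            inf_le_left := ?_
            inf_le_right := ?_
            le_inf := ?_
            le_sup_inf := ?_ }, ?_, ?_, ?_⟩
  · intro C D k
    simp only [card_join]; omega
  · intro C D k
    simp only [card_join]; omega
  · intro C D E h h' k
    have := h k
    have := h' k
    simp only [card_join]; omega
  · intro C D k
    simp only [card_meet]; omega
  · intro C D k
    simp only [card_meet]; omega
  · intro C D E h h' k
    have := h k
    have := h' k
    simp only [card_meet]; omega
  · intro C D E k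
    change (meetFun P A (joinFun P A C.1 D.1) (joinFun P A C.1 E.1) k ∩ A).card ≤
      (joinFun P A C.1 (meetFun P A D.1 E.1) k ∩ A).card
    simp only [card_meet, card_join]; omega
  · intro C D; exact Iff.rfl
  · intro C D; rfl
  · intro C D; rfl
end

section
/- Let P be a finite poset and let p_1, …, p_n (n ≥ 3) be a pairwise incomparable family of distinct elements of P. Let I = {q ∈ P : q < p_i for some i}, and set a = |I| + 1. For each i set t_i = I ∪ {p_i}, and for i ≠ j set t_{i,j} = I ∪ {p_i, p_j}. Then all t_i and t_{i,j} are order ideals of P, the t_i have cardinality a, the t_{i,j} have cardinality a + 1, and the sequence t_1, t_{1,2}, t_2, t_{2,3}, t_3, …, t_{n-1,n}, t_n, t_{n,1} is an induced cycle of length 2n in the graph H_{a}. -/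
variable {P : Type*} [PartialOrder P] [Fintype P] [DecidableEq P]

-- The order ideal `I = {q ∈ P : q < p_i for some i}`.
open Classical in
noncomputable def lowerStrict {n : ℕ} (p : Fin n → P) : Finset P :=
  Finset.univ.filter fun q => ∃ i, q < p i

/-- The order ideal `t_i = I ∪ {p_i}`. -/
noncomputable def cycTop {n : ℕ} (p : Fin n → P) (i : Fin n) : Finset P :=
  lowerStrict p ∪ {p i}

/-- The order ideal `t_{i,j} = I ∪ {p_i, p_j}`. -/
noncomputable def cycPair {n : ℕ} (p : Fin n → P) (i j : Fin n) : Finset P :=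
  lowerStrict p ∪ {p i, p j}

/-- The sequence `t_1, t_{1,2}, t_2, t_{2,3}, …, t_n, t_{n,1}` of order ideals. -/
noncomputable def cycleSeq {n : ℕ} (p : Fin n → P) (j : Fin (2 * n)) : Finset P :=
  if (j : ℕ) % 2 = 0 then cycTop p ⟨(j : ℕ) / 2, by have := j.2; omega⟩
  else cycPair p ⟨(j : ℕ) / 2, by have := j.2; omega⟩
    ⟨((j : ℕ) / 2 + 1) % n, by have := j.2; exact Nat.mod_lt _ (by omega)⟩

lemma mem_lowerStrict' {n : ℕ} (p : Fin n → P) (q : P) :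
    q ∈ lowerStrict p ↔ ∃ i, q < p i := by
  simp [lowerStrict]

lemma not_mem_lowerStrict' {n : ℕ} (p : Fin n → P)
    (hanti : ∀ i j, i ≠ j → ¬ p i ≤ p j) (k : Fin n) : p k ∉ lowerStrict p := by
  rw [mem_lowerStrict']
  rintro ⟨i, hi⟩
  by_cases h : k = i
  · subst h; exact lt_irrefl _ hi
  · exact hanti k i h hi.le

lemma isLower_aux {n : ℕ} (p : Fin n → P) (s : Finset P) (hs : ∀ x ∈ s, ∃ i, x = p i) :
    IsLowerSet ((lowerStrict p ∪ s : Finset P) : Set P) := by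
  intro x y hyx hx
  simp only [Finset.coe_union, Set.mem_union, Finset.mem_coe, mem_lowerStrict'] at hx ⊢
  rcases hyx.eq_or_lt with rfl | hlt
  · exact hx
  · left
    rcases hx with ⟨i, hi⟩ | hx
    · exact ⟨i, hlt.trans hi⟩
    · obtain ⟨i, rfl⟩ := hs x hx
      exact ⟨i, hlt⟩

lemma mod_aux (x n : ℕ) (h : x < n) :
    (x + 1 < n ∧ (x + 1) % n = x + 1) ∨ (x + 1 = n ∧ (x + 1) % n = 0) := by
  rcases Nat.lt_or_ge (x + 1) n with h1 | h1
  · exact Or.inl ⟨h1, Nat.mod_eq_of_lt h1⟩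
  · have : x + 1 = n := by omega
    exact Or.inr ⟨this, by rw [this, Nat.mod_self]⟩

lemma mem_cycleSeq {n : ℕ} (p : Fin n → P) (j : Fin (2 * n)) (q : P) :
    q ∈ cycleSeq p j ↔ q ∈ lowerStrict p ∨ ∃ k : Fin n, q = p k ∧
      ((k : ℕ) = j / 2 ∨ ((j : ℕ) % 2 = 1 ∧ (k : ℕ) = (j / 2 + 1) % n)) := by
  unfold cycleSeq
  split_ifs with h
  · simp only [cycTop, Finset.mem_union, Finset.mem_singleton]
    refine or_congr_right ⟨fun e => ⟨_, e, Or.inl rfl⟩, ?_⟩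
    rintro ⟨k, rfl, hk | hk⟩
    · congr 1; exact Fin.ext hk
    · omega
  · simp only [cycPair, Finset.mem_union, Finset.mem_insert, Finset.mem_singleton]
    refine or_congr_right ⟨?_, ?_⟩
    · rintro (e | e)
      · exact ⟨_, e, Or.inl rfl⟩
      · exact ⟨_, e, Or.inr ⟨by omega, rfl⟩⟩
    · rintro ⟨k, rfl, hk | hk⟩
      · left; congr 1; exact Fin.ext hk
      · right; congr 1; exact Fin.ext hk.2

lemma cycleSeq_subset {n : ℕ} (p : Fin n → P)
    (hinj : Function.Injective p) (hanti : ∀ i j, i ≠ j → ¬ p i ≤ p j) (i j : Fin (2 * n)) :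
    cycleSeq p i ⊆ cycleSeq p j ↔ ∀ k : ℕ, k < n →
      (k = (i : ℕ) / 2 ∨ ((i : ℕ) % 2 = 1 ∧ k = ((i : ℕ) / 2 + 1) % n)) →
      (k = (j : ℕ) / 2 ∨ ((j : ℕ) % 2 = 1 ∧ k = ((j : ℕ) / 2 + 1) % n)) := by
  constructor
  · intro h k hk hi
    have := h ((mem_cycleSeq p i (p ⟨k, hk⟩)).2 (Or.inr ⟨_, rfl, hi⟩))
    rw [mem_cycleSeq] at this
    rcases this with h1 | ⟨k', h1, h2⟩
    · exact absurd h1 (not_mem_lowerStrict' p hanti _)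
    · rw [← hinj h1] at h2; exact h2
  · intro h q hq
    rw [mem_cycleSeq] at hq ⊢
    rcases hq with h1 | ⟨k, h1, h2⟩
    · exact Or.inl h1
    · exact Or.inr ⟨k, h1, h k k.2 h2⟩

lemma cycleSeq_subset' {n : ℕ} (p : Fin n → P)
    (hinj : Function.Injective p) (hanti : ∀ i j, i ≠ j → ¬ p i ≤ p j) (i j : Fin (2 * n)) :
    cycleSeq p i ⊆ cycleSeq p j ↔
      ((i : ℕ) / 2 = (j : ℕ) / 2 ∨ ((j : ℕ) % 2 = 1 ∧ (i : ℕ) / 2 = ((j : ℕ) / 2 + 1) % n)) ∧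
      ((i : ℕ) % 2 = 1 → (((i : ℕ) / 2 + 1) % n = (j : ℕ) / 2 ∨
        ((j : ℕ) % 2 = 1 ∧ ((i : ℕ) / 2 + 1) % n = ((j : ℕ) / 2 + 1) % n))) := by
  rw [cycleSeq_subset p hinj hanti]
  have hi := i.2
  constructor
  · intro h
    exact ⟨h _ (by omega) (Or.inl rfl),
      fun h1 => h _ (Nat.mod_lt _ (by omega)) (Or.inr ⟨h1, rfl⟩)⟩
  · rintro ⟨h1, h2⟩ k hk (rfl | ⟨h3, rfl⟩)
    · exact h1
    · exact h2 h3

/-- Given pairwise incomparable distinct elements `p_1, …, p_n` (`n ≥ 3`)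
of `P`, with `I = {q : q < p_i for some i}` and `a = |I| + 1`, the sets `t_i = I ∪ {p_i}`
and `t_{i,j} = I ∪ {p_i, p_j}` are order ideals of cardinality `a` and `a + 1`
respectively, and the sequence `t_1, t_{1,2}, t_2, …, t_n, t_{n,1}` is an induced cycle of
length `2n` in the graph `H_a`. -/
theorem cycleSeq_inducedCycle (n : ℕ) (hn : 3 ≤ n) (p : Fin n → P)
    (hinj : Function.Injective p)
    (hanti : ∀ i j, i ≠ j → ¬ p i ≤ p j) :
    (∀ i, IsLowerSet ((cycTop p i : Finset P) : Set P)) ∧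
      (∀ i j, i ≠ j → IsLowerSet ((cycPair p i j : Finset P) : Set P)) ∧
      (∀ i, (cycTop p i).card = (lowerStrict p).card + 1) ∧
      (∀ i j, i ≠ j → (cycPair p i j).card = (lowerStrict p).card + 1 + 1) ∧
      Function.Injective (cycleSeq p) ∧
      (∀ i j : Fin (2 * n), (cycleSeq p i ⊂ cycleSeq p j ∨ cycleSeq p j ⊂ cycleSeq p i) ↔
        (((i : ℕ) + 1) % (2 * n) = (j : ℕ) ∨ ((j : ℕ) + 1) % (2 * n) = (i : ℕ))) := by
  have hI := not_mem_lowerStrict' p hanti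
  refine ⟨?_, ?_, ?_, ?_, ?_, ?_⟩
  · intro i
    exact isLower_aux p _ (by simp)
  · intro i j _
    exact isLower_aux p _ (by
      intro x hx
      simp only [Finset.mem_insert, Finset.mem_singleton] at hx
      rcases hx with h | h
      · exact ⟨i, h⟩
      · exact ⟨j, h⟩)
  · intro i
    rw [cycTop, Finset.card_union_of_disjoint (by simpa using hI i), Finset.card_singleton]
  · intro i j hij
    rw [cycPair, Finset.card_union_of_disjoint, Finset.card_pair (fun h => hij (hinj h))]
    simp [hI i, hI j]
  · intro i j h
    have h1 := (cycleSeq_subset' p hinj hanti i j).1 h.subset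
    have h2 := (cycleSeq_subset' p hinj hanti j i).1 h.symm.subset
    have hi := i.2
    have hj := j.2
    have hm := mod_aux ((i : ℕ) / 2) n (by omega)
    have hm' := mod_aux ((j : ℕ) / 2) n (by omega)
    apply Fin.ext
    generalize ((i : ℕ) / 2 + 1) % n = s at *
    generalize ((j : ℕ) / 2 + 1) % n = t at *
    omega
  · intro i j
    rw [ssubset_iff_subset_not_subset, ssubset_iff_subset_not_subset,
      cycleSeq_subset' p hinj hanti i j, cycleSeq_subset' p hinj hanti j i]
    have hi := i.2
    have hj := j.2
    have hm := mod_aux ((i : ℕ) / 2) n (by omega)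
    have hm' := mod_aux ((j : ℕ) / 2) n (by omega)
    have hk := mod_aux (i : ℕ) (2 * n) (by omega)
    have hk' := mod_aux (j : ℕ) (2 * n) (by omega)
    generalize ((i : ℕ) / 2 + 1) % n = s at *
    generalize ((j : ℕ) / 2 + 1) % n = t at *
    generalize ((i : ℕ) + 1) % (2 * n) = u at *
    generalize ((j : ℕ) + 1) % (2 * n) = v at *
    rcases Nat.mod_two_eq_zero_or_one i with e | e <;>
      rcases Nat.mod_two_eq_zero_or_one j with e' | e' <;>
      simp only [e, e', true_and, false_and, true_implies, false_implies, or_false, and_true,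
        zero_ne_one] <;> 
      rcases hm with hm | hm <;> rcases hm' with hm' | hm' <;> constructor <;> intro h <;> omega
end

section
/- Let K be a field and let ψ : K[T_1, …, T_6] → K[x, y, z, w] be the K-algebra homomorphism with ψ(T_1) = xy, ψ(T_2) = xz, ψ(T_3) = xw, ψ(T_4) = yz, ψ(T_5) = yw, ψ(T_6) = zw. Then ker ψ is the ideal generated by the two binomials T_1 T_6 − T_2 T_5 and T_3 T_4 − T_2 T_5. -/
open MvPolynomial

/-- Exponents with equal images give equal monomials once the three products agree. -/
lemma sqv_pow_eq {R : Type*} [CommRing R] (t0 t1 t2 t3 t4 t5 : R)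
    (h1 : t0 * t5 = t1 * t4) (h2 : t2 * t3 = t1 * t4)
    (a0 a1 a2 a3 a4 a5 b0 b1 b2 b3 b4 b5 : ℕ)
    (hx : a0 + a1 + a2 = b0 + b1 + b2) (hy : a0 + a3 + a4 = b0 + b3 + b4)
    (hz : a1 + a3 + a5 = b1 + b3 + b5) (hw : a2 + a4 + a5 = b2 + b4 + b5) :
    t0 ^ a0 * t1 ^ a1 * t2 ^ a2 * t3 ^ a3 * t4 ^ a4 * t5 ^ a5 =
    t0 ^ b0 * t1 ^ b1 * t2 ^ b2 * t3 ^ b3 * t4 ^ b4 * t5 ^ b5 := by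
  have key : ∀ m0 m1 m2 m3 m4 m5 e0 e1 e2 : ℕ,
      t0 ^ (m0 + e0) * t1 ^ (m1 + e1) * t2 ^ (m2 + e2) * t3 ^ (m3 + e2) * t4 ^ (m4 + e1)
        * t5 ^ (m5 + e0) =
      t0 ^ m0 * t1 ^ m1 * t2 ^ m2 * t3 ^ m3 * t4 ^ m4 * t5 ^ m5 * (t1 * t4) ^ (e0 + e1 + e2) := by
    intro m0 m1 m2 m3 m4 m5 e0 e1 e2
    have : (t1 * t4) ^ (e0 + e1 + e2) = (t0 * t5) ^ e0 * (t1 * t4) ^ e1 * (t2 * t3) ^ e2 := by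
      rw [h1, h2, pow_add, pow_add]
    rw [this]
    simp only [mul_pow, pow_add]
    ring
  have ka := key (min a0 b0) (min a1 b1) (min a2 b2) (min a3 b3) (min a4 b4) (min a5 b5)
    (a0 - b0) (a1 - b1) (a2 - b2)
  have kb := key (min a0 b0) (min a1 b1) (min a2 b2) (min a3 b3) (min a4 b4) (min a5 b5)
    (b0 - a0) (b1 - a1) (b2 - a2)
  rw [show min a0 b0 + (a0 - b0) = a0 by omega, show min a1 b1 + (a1 - b1) = a1 by omega,
    show min a2 b2 + (a2 - b2) = a2 by omega, show min a3 b3 + (a2 - b2) = a3 by omega,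
    show min a4 b4 + (a1 - b1) = a4 by omega, show min a5 b5 + (a0 - b0) = a5 by omega] at ka
  rw [show min a0 b0 + (b0 - a0) = b0 by omega, show min a1 b1 + (b1 - a1) = b1 by omega,
    show min a2 b2 + (b2 - a2) = b2 by omega, show min a3 b3 + (b2 - a2) = b3 by omega,
    show min a4 b4 + (b1 - a1) = b4 by omega, show min a5 b5 + (b0 - a0) = b5 by omega] at kb
  rw [ka, kb, show a0 - b0 + (a1 - b1) + (a2 - b2) = b0 - a0 + (b1 - a1) + (b2 - a2) by omega]

/-- The exponent map. -/
noncomputable def sqvExp (a : Fin 6 →₀ ℕ) : Fin 4 →₀ ℕ :=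
  Finsupp.equivFunOnFinite.symm
    ![a 0 + a 1 + a 2, a 0 + a 3 + a 4, a 1 + a 3 + a 5, a 2 + a 4 + a 5]

lemma sqv_aeval_monomial (K : Type*) [Field K] (a : Fin 6 →₀ ℕ) :
    aeval (R := K) ![(X 0 : MvPolynomial (Fin 4) K) * X 1, X 0 * X 2, X 0 * X 3,
          X 1 * X 2, X 1 * X 3, X 2 * X 3] (monomial a (1 : K)) = monomial (sqvExp a) 1 := by
  rw [aeval_monomial, monomial_eq, Finsupp.prod_fintype _ _ (by simp),
    Finsupp.prod_fintype _ _ (by simp)]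
  simp [Fin.prod_univ_succ, sqvExp]
  simp [Fin.succ, mul_pow, pow_add]
  ring

theorem ker_squarefreeVeronese (K : Type*) [Field K] :
    RingHom.ker (aeval (R := K)
        ![(X 0 : MvPolynomial (Fin 4) K) * X 1, X 0 * X 2, X 0 * X 3,
          X 1 * X 2, X 1 * X 3, X 2 * X 3] :
        MvPolynomial (Fin 6) K →ₐ[K] MvPolynomial (Fin 4) K).toRingHom =
      Ideal.span {(X 0 : MvPolynomial (Fin 6) K) * X 5 - X 1 * X 4,
        X 2 * X 3 - X 1 * X 4} := by
  apply le_antisymm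
  · set I := Ideal.span {(X 0 : MvPolynomial (Fin 6) K) * X 5 - X 1 * X 4,
        X 2 * X 3 - X 1 * X 4} with hI
    set ψ := (aeval (R := K)
        ![(X 0 : MvPolynomial (Fin 4) K) * X 1, X 0 * X 2, X 0 * X 3,
          X 1 * X 2, X 1 * X 3, X 2 * X 3] :
        MvPolynomial (Fin 6) K →ₐ[K] MvPolynomial (Fin 4) K) with hψ
    let q := Ideal.Quotient.mkₐ K I
    have h1 : q (X 0) * q (X 5) = q (X 1) * q (X 4) := by
      rw [← map_mul, ← map_mul]
      exact Ideal.Quotient.eq.2 (Ideal.subset_span (by simp))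
    have h2 : q (X 2) * q (X 3) = q (X 1) * q (X 4) := by
      rw [← map_mul, ← map_mul]
      exact Ideal.Quotient.eq.2 (Ideal.subset_span (by simp))
    have hq : ∀ a b, sqvExp a = sqvExp b → q (monomial a 1) = q (monomial b 1) := by
      intro a b hab
      have e0 := DFunLike.congr_fun hab 0
      have e1 := DFunLike.congr_fun hab 1
      have e2 := DFunLike.congr_fun hab 2
      have e3 := DFunLike.congr_fun hab 3
      simp [sqvExp] at e0 e1 e2 e3
      have hm : ∀ a : Fin 6 →₀ ℕ, q (monomial a 1) = q (X 0) ^ a 0 * q (X 1) ^ a 1 *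
          q (X 2) ^ a 2 * q (X 3) ^ a 3 * q (X 4) ^ a 4 * q (X 5) ^ a 5 := by
        intro a
        rw [monomial_eq, Finsupp.prod_fintype _ _ (by simp), Fin.prod_univ_six]
        simp only [map_mul, map_pow, map_one, one_mul]
      rw [hm, hm]
      exact sqv_pow_eq _ _ _ _ _ _ h1 h2 _ _ _ _ _ _ _ _ _ _ _ _ e0 e1 e2 e3
    let L := (basisMonomials (Fin 4) K).constr K
      (fun m => q (monomial (Function.invFun sqvExp m) 1))
    have hL : L ∘ₗ ψ.toLinearMap = q.toLinearMap := by
      apply (basisMonomials (Fin 6) K).ext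
      intro a
      have : ψ (monomial a 1) = basisMonomials (Fin 4) K (sqvExp a) := by
        rw [hψ, sqv_aeval_monomial, coe_basisMonomials]
      simp only [coe_basisMonomials, LinearMap.comp_apply, AlgHom.toLinearMap_apply]
      rw [this, Module.Basis.constr_basis]
      exact hq _ _ (Function.invFun_eq ⟨a, rfl⟩)
    intro p hp
    have hp' : ψ p = 0 := hp
    have := LinearMap.congr_fun hL p
    simp only [LinearMap.comp_apply, AlgHom.toLinearMap_apply, hp', map_zero] at this
    exact Ideal.Quotient.eq_zero_iff_mem.1 this.symm
  · rw [Ideal.span_le]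
    rintro p (rfl | rfl) <;>
    · simp [RingHom.mem_ker]
      ring
end
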